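/- Let S⃗ be a universe of set separations with an order function |.|, let k ∈ ℕ, let (T,α) be a tame S_k-tree, let e⃗ be an oriented edge of T with α(e⃗) = (A,B), and let (X,Y) be linked to (A,B). Then the shift of (T,α) onto (X,Y) with respect to e⃗ is a tame S_k-tree. -/

import Mathlib

open scoped Classical

noncomputable section

/-- An oriented separation of `V`: an ordered pair of subsets. -/
abbrev OSep (V : Type*) := Set V × Set V

namespace OSep

/-- The involution `(A,B)* = (B,A)`. -/
def flip {V : Type*} (s : OSep V) : OSep V := (s.2, s.1)

/-- The partial order `(A,B) ≤ (C,D) iff A ⊆ C and D ⊆ B`. -/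
def le {V : Type*} (s t : OSep V) : Prop := s.1 ⊆ t.1 ∧ t.2 ⊆ s.2

/-- The infimum `(A,B) ∧ (C,D) = (A ∩ C, B ∪ D)`. -/
def inter {V : Type*} (s t : OSep V) : OSep V := (s.1 ∩ t.1, s.2 ∪ t.2)

/-- The supremum `(A,B) ∨ (C,D) = (A ∪ C, B ∩ D)`. -/
def union {V : Type*} (s t : OSep V) : OSep V := (s.1 ∪ t.1, s.2 ∩ t.2)

end OSep

/-- A universe of set separations: a set of oriented separations (pairs covering `V`)
closed under the involution and under ∧ and ∨. -/
structure IsUniverse {V : Type*} (S : Set (OSep V)) : Prop where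
  covers : ∀ s ∈ S, s.1 ∪ s.2 = Set.univ
  flip_mem : ∀ s ∈ S, s.flip ∈ S
  inter_mem : ∀ s ∈ S, ∀ t ∈ S, s.inter t ∈ S
  union_mem : ∀ s ∈ S, ∀ t ∈ S, s.union t ∈ S

/-- An order function on a universe `S`: symmetric and submodular (non-negativity is
automatic for `ℕ`-valued functions). -/
structure IsOrderFun {V : Type*} (S : Set (OSep V)) (ord : OSep V → ℕ) : Prop where
  symm : ∀ s ∈ S, ord s.flip = ord s
  submod : ∀ s ∈ S, ∀ t ∈ S, ord (s.inter t) + ord (s.union t) ≤ ord s + ord t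

/-- A universe with an order function is grounded if `|A ∪ C, B ∩ D| ≤ |C,D|`
whenever `(B,A) ≤ (C,D)`. -/
def Grounded {V : Type*} (S : Set (OSep V)) (ord : OSep V → ℕ) : Prop :=
  ∀ s ∈ S, ∀ t ∈ S, OSep.le s.flip t → ord (s.union t) ≤ ord t

/-- A submodular function on subsets of `V`. -/
def Submodular {V : Type*} (r : Set V → ℕ) : Prop :=
  ∀ X Y : Set V, r (X ∩ Y) + r (X ∪ Y) ≤ r X + r Y

/-- The order function `|X,Y|_r = r(X) + r(Y) - r(V)` induced by `r`. -/
def ordOf {V : Type*} (r : Set V → ℕ) (s : OSep V) : ℕ := r s.1 + r s.2 - r Set.univ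

/-- A multiset of oriented separations is a star if `(A,B) ≤ (D,C)` for every two of its
members occupying distinct positions. -/
def IsStar {V : Type*} (σ : Multiset (OSep V)) : Prop :=
  ∀ a b : OSep V, (a ::ₘ {b}) ≤ σ → OSep.le a b.flip

/-- The size `⟨σ⟩_r = Σᵢ r(Bᵢ) − n · r(V)` of a star `σ = {(A₀,B₀),…,(Aₙ,Bₙ)}`. -/
def starSize {V : Type*} (r : Set V → ℕ) (σ : Multiset (OSep V)) : ℕ :=
  (σ.map fun s => r s.2).sum - (Multiset.card σ - 1) * r Set.univ

/-- `λ((A,B),(C,D)) = min { |X,Y| : (X,Y) ∈ S, (A,B) ≤ (X,Y) ≤ (C,D) }`. -/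
def lam {V : Type*} (S : Set (OSep V)) (ord : OSep V → ℕ) (a c : OSep V) : ℕ :=
  sInf (ord '' {s | s ∈ S ∧ OSep.le a s ∧ OSep.le s c})

/-- `(X,Y)` is linked to `(A,B)` if `(A,B) ≤ (X,Y)` and `|X,Y| = λ((A,B),(X,Y))`. -/
def IsLinkedSep {V : Type*} (S : Set (OSep V)) (ord : OSep V → ℕ) (a x : OSep V) : Prop :=
  x ∈ S ∧ OSep.le a x ∧ ord x = lam S ord a x

/-- `σ_t`: the multiset of labels of the oriented edges (darts) pointing towards `t`. -/
def starAt {W : Type*} [Fintype W] {V : Type*} (T : SimpleGraph W) (α : T.Dart → OSep V)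
    (t : W) : Multiset (OSep V) :=
  ((Finset.univ : Finset T.Dart).filter fun d => d.toProd.2 = t).val.map α

/-- The natural ordering on the oriented edges (darts) of a tree: `d ≤ d'` iff both lie
(in that direction) on the path from the tail of `d` to the head of `d'`. -/
def dartLE {W : Type*} (T : SimpleGraph W) (d d' : T.Dart) : Prop :=
  ∀ p : T.Walk d.toProd.1 d'.toProd.2, p.IsPath → d ∈ p.darts ∧ d' ∈ p.darts

/-- The vertex set of the subtree `T(e⃗)`: the component of `T - x` containing `y` together
with `x` itself, for `e⃗ = (x,y)`. -/
def shiftSet {W : Type*} (T : SimpleGraph W) (e : T.Dart) : Set W :=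
  {v | v = e.toProd.1 ∨ ∀ p : T.Walk e.toProd.1 v, p.IsPath → e ∈ p.darts}

/-- A dart of an induced subgraph, as a dart of the ambient graph. -/
def liftDart {W : Type*} {T : SimpleGraph W} {U : Set W} (d : (T.induce U).Dart) : T.Dart :=
  ⟨(d.toProd.1.val, d.toProd.2.val), d.adj⟩

/-- The labelling `α'` of the shift of `(T,α)` onto `(X,Y)` with respect to `e⃗`:
a dart `f` of `T(e⃗)` with `e⃗ ≤ f⃗` gets `α(f⃗) ∨ (X,Y)`, and the reverse darts get the
flipped labels. -/
def shiftAlpha {W : Type*} {V : Type*} (T : SimpleGraph W) (α : T.Dart → OSep V)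
    (e : T.Dart) (X : OSep V) : (T.induce (shiftSet T e)).Dart → OSep V :=
  fun d =>
    if dartLE T e (liftDart d) then (α (liftDart d)).union X
    else ((α (liftDart d).symm).union X).flip

/-- A family `F` of stars is fixed under shifting if for every tame `S`-tree `(T,α)`,
every oriented edge `e⃗ = (t,t')` of `T`, every vertex `s ≠ t` of `T(e⃗)` with
`α(F⃗_s) ∈ F`, and every `(X,Y)` linked to `α(e⃗)`, in the shift of `(T,α)` onto `(X,Y)`
with respect to `e⃗` one has `α'(F⃗_s) ∈ F`. -/
def FixedUnderShifting {V : Type*} (S : Set (OSep V)) (ord : OSep V → ℕ)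
    (F : Set (Multiset (OSep V))) : Prop :=
  ∀ (n : ℕ) (T : SimpleGraph (Fin n)) (α : T.Dart → OSep V) (e : T.Dart) (X : OSep V)
    (s : ↥(shiftSet T e)),
    T.IsTree → (∀ d, α d.symm = (α d).flip) → (∀ d, α d ∈ S) →
    (∀ t, IsStar (starAt T α t)) →
    (s : Fin n) ≠ e.toProd.1 → starAt T α (s : Fin n) ∈ F →
    IsLinkedSep S ord (α e) X →
    starAt (T.induce (shiftSet T e)) (shiftAlpha T α e X) s ∈ F

/-- A linked `S_k`-tree: for every two darts `e⃗ ≤ f⃗`, the minimum order of a label on the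
path from `e` to `f` equals `λ(α(e⃗), α(f⃗))`. -/
def IsLinkedTree {W : Type*} {V : Type*} (S : Set (OSep V)) (ord : OSep V → ℕ)
    (T : SimpleGraph W) (α : T.Dart → OSep V) : Prop :=
  ∀ e f : T.Dart, dartLE T e f →
    sInf ((fun g => ord (α g)) '' {g | dartLE T e g ∧ dartLE T g f}) =
      lam S ord (α e) (α f)

/-- An `F`-lean `S_k`-tree with respect to the ground function `r`. -/
def IsLeanTree {W : Type*} [Fintype W] {V : Type*} (S : Set (OSep V)) (ord : OSep V → ℕ)
    (r : Set V → ℕ) (T : SimpleGraph W) (α : T.Dart → OSep V)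
    (F : Set (Multiset (OSep V))) : Prop :=
  ∀ (t t' : W) (a b : OSep V), OSep.le a b.flip →
    (a ::ₘ starAt T α t) ∈ F → (b ::ₘ starAt T α t') ∈ F →
    (min (r a.1) (r b.1) ≤ lam S ord a b.flip ∨
      ∀ p : T.Walk t t', p.IsPath →
        sInf ((fun d => ord (α d)) '' {d | d ∈ p.darts}) = lam S ord a b.flip)

/-- `int(σ) = ⋂ᵢ Bᵢ` for `σ = {(A₀,B₀),…,(Aₙ,Bₙ)}`. -/
def intStar {V : Type*} (σ : Multiset (OSep V)) : Set V := {v | ∀ s ∈ σ, v ∈ s.2}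

/-- The universe of oriented separations of a graph `G`: pairs `(A,B)` of vertex sets with
`A ∪ B = V(G)` and no edge between `A ∖ B` and `B ∖ A`. -/
def graphSeps {V : Type*} (G : SimpleGraph V) : Set (OSep V) :=
  {s | s.1 ∪ s.2 = Set.univ ∧ ∀ a ∈ s.1 \ s.2, ∀ b ∈ s.2 \ s.1, ¬ G.Adj a b}

/-- `G` contains `k` vertex-disjoint `Z₁`–`Z₂` paths. -/
def HasDisjointPaths {V : Type*} (G : SimpleGraph V) (Z₁ Z₂ : Set V) (k : ℕ) : Prop :=
  ∃ (u v : Fin k → V) (p : ∀ i, G.Walk (u i) (v i)),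
    (∀ i, (p i).IsPath) ∧ (∀ i, u i ∈ Z₁) ∧ (∀ i, v i ∈ Z₂) ∧
    ∀ i j, i ≠ j → ∀ x, x ∈ (p i).support → x ∉ (p j).support

/-- `(T, B)` is a tree-decomposition of the graph `G`. -/
def IsTreeDecomp {V : Type*} {n : ℕ} (G : SimpleGraph V) (T : SimpleGraph (Fin n))
    (B : Fin n → Set V) : Prop :=
  T.IsTree ∧ (∀ v, ∃ t, v ∈ B t) ∧ (∀ u w, G.Adj u w → ∃ t, u ∈ B t ∧ w ∈ B t) ∧
  (∀ t₁ t₂ t₃ : Fin n, ∀ p : T.Walk t₁ t₃, p.IsPath → t₂ ∈ p.support → B t₁ ∩ B t₃ ⊆ B t₂)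

/-- The width of a tree-decomposition: `max |V_t| − 1`. -/
def tdWidth {V : Type*} {n : ℕ} (B : Fin n → Set V) : ℕ :=
  (Finset.univ.sup fun t => (B t).ncard) - 1

/-- The tree-width of a graph. -/
def treeWidth {V : Type*} (G : SimpleGraph V) : ℕ :=
  sInf {w | ∃ (n : ℕ) (T : SimpleGraph (Fin n)) (B : Fin n → Set V),
    IsTreeDecomp G T B ∧ tdWidth B = w}

/-- The path-width of a graph: minimum width of a tree-decomposition whose tree is a path. -/
def pathWidth {V : Type*} (G : SimpleGraph V) : ℕ :=
  sInf {w | ∃ (n : ℕ) (B : Fin n → Set V),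
    IsTreeDecomp G (SimpleGraph.pathGraph n) B ∧ tdWidth B = w}

/-- A linked tree-decomposition of a graph. -/
def IsLinkedDecomp {V : Type*} {n : ℕ} (G : SimpleGraph V) (T : SimpleGraph (Fin n))
    (B : Fin n → Set V) : Prop :=
  ∀ (k : ℕ) (t t' : Fin n),
    HasDisjointPaths G (B t) (B t') k ∨
    ∀ p : T.Walk t t', p.IsPath →
      ∃ d ∈ p.darts, (B d.toProd.1 ∩ B d.toProd.2).ncard < k

/-- A lean tree-decomposition of a graph. -/
def IsLeanDecomp {V : Type*} {n : ℕ} (G : SimpleGraph V) (T : SimpleGraph (Fin n))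
    (B : Fin n → Set V) : Prop :=
  ∀ (k : ℕ) (t t' : Fin n) (Z₁ Z₂ : Set V), Z₁ ⊆ B t → Z₂ ⊆ B t' →
    Z₁.ncard = k → Z₂.ncard = k →
    HasDisjointPaths G Z₁ Z₂ k ∨
    ∀ p : T.Walk t t', p.IsPath →
      ∃ d ∈ p.darts, (B d.toProd.1 ∩ B d.toProd.2).ncard < k
/-- The rank function of a matroid: `r(X)` is the maximum size of an independent subset
of `X`. -/
def mRank {α : Type*} (M : Matroid α) (X : Set α) : ℕ :=
  sSup {k | ∃ I, I ⊆ X ∧ M.Indep I ∧ I.ncard = k}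

/-- The connectivity `λ(X) = r(X) + r(E ∖ X) − r(E)` of `X ⊆ E`. -/
def mConn {α : Type*} (M : Matroid α) (X : Set α) : ℕ :=
  mRank M X + mRank M Xᶜ - mRank M Set.univ

/-- For a dart `d = (s,s')` of a tree `T`, the component of `T − s'` containing `s`. -/
def branch {W : Type*} (T : SimpleGraph W) (d : T.Dart) : Set W :=
  {w | ∀ p : T.Walk d.toProd.2 w, p.IsPath → d.toProd.1 ∈ p.support}

/-- The darts of `T` pointing towards `t`. -/
def dartsTo {W : Type*} [Fintype W] (T : SimpleGraph W) (t : W) : Finset T.Dart :=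
  Finset.univ.filter fun d => d.toProd.2 = t

/-- The width `Σᵢ r(E ∖ τ⁻¹(Tᵢ)) − (d−1)·r(E)` of the bag of a matroid tree-decomposition
at `v`, where the `Tᵢ` are the components of `T − v`. -/
def mBagWidth {α : Type*} {n : ℕ} (M : Matroid α) (T : SimpleGraph (Fin n))
    (τ : α → Fin n) (v : Fin n) : ℕ :=
  ((∑ d ∈ dartsTo T v, mRank M ((τ ⁻¹' branch T d)ᶜ)) + mRank M Set.univ)
    - (dartsTo T v).card * mRank M Set.univ

/-- The width of a matroid tree-decomposition: the maximum width of a bag. -/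
def mWidth {α : Type*} {n : ℕ} (M : Matroid α) (T : SimpleGraph (Fin n))
    (τ : α → Fin n) : ℕ :=
  Finset.univ.sup (mBagWidth M T τ)

/-- The tree-width of a matroid. -/
def matroidTreeWidth {α : Type*} (M : Matroid α) : ℕ :=
  sInf {w | ∃ (n : ℕ) (T : SimpleGraph (Fin n)) (_ : T.IsTree) (τ : α → Fin n),
    mWidth M T τ = w}

/-- `λ(Z₁,Z₂) = min {λ(X) : Z₁ ⊆ X ⊆ E ∖ Z₂}` for disjoint `Z₁, Z₂ ⊆ E`. -/
def mLam {α : Type*} (M : Matroid α) (Z₁ Z₂ : Set α) : ℕ :=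
  sInf (mConn M '' {X | Z₁ ⊆ X ∧ X ⊆ Z₂ᶜ})

/-- A lean matroid tree-decomposition. -/
def IsLeanMDecomp {α : Type*} {n : ℕ} (M : Matroid α) (T : SimpleGraph (Fin n))
    (τ : α → Fin n) : Prop :=
  ∀ (k : ℕ) (t t' : Fin n) (Z₁ Z₂ : Set α), Z₁ ⊆ τ ⁻¹' {t} → Z₂ ⊆ τ ⁻¹' {t'} →
    Disjoint Z₁ Z₂ → mRank M Z₁ = k → mRank M Z₂ = k →
    k ≤ mLam M Z₁ Z₂ ∨
    ∀ p : T.Walk t t', p.IsPath → ∃ d ∈ p.darts, mConn M (τ ⁻¹' branch T d) < k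

/-- A linked matroid tree-decomposition. -/
def IsLinkedMDecomp {α : Type*} {n : ℕ} (M : Matroid α) (T : SimpleGraph (Fin n))
    (τ : α → Fin n) : Prop :=
  ∀ e f : T.Dart, dartLE T e f →
    sInf ((fun g => mConn M (τ ⁻¹' branch T g)) '' {g | dartLE T e g ∧ dartLE T g f}) =
      sInf (mConn M '' {X | τ ⁻¹' branch T e ⊆ X ∧ X ⊆ τ ⁻¹' branch T f})
/-- Two oriented separations are nested if they have `≤`-comparable orientations. -/
def Nested {V : Type*} (s t : OSep V) : Prop :=
  OSep.le s t ∨ OSep.le s t.flip ∨ OSep.le s.flip t ∨ OSep.le s.flip t.flip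

section Tree

variable {W : Type*} {T : SimpleGraph W}

/-- The dart `d` is oriented away from the vertex `x`. -/
def PointsAway (T : SimpleGraph W) (x : W) (d : T.Dart) : Prop :=
  ∃ p : T.Walk x d.toProd.1, p.IsPath ∧ d.toProd.2 ∉ p.support

theorem SimpleGraph.IsTree.path_eq (hT : T.IsTree) {u v : W} {p q : T.Walk u v}
    (hp : p.IsPath) (hq : q.IsPath) : p = q :=
  (hT.existsUnique_path u v).unique hp hq

theorem pointsAway_or_symm (hT : T.IsTree) (x : W) (d : T.Dart) :
    PointsAway T x d ∨ PointsAway T x d.symm := by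
  obtain ⟨p, hp, -⟩ := hT.existsUnique_path x d.toProd.1
  obtain ⟨q, hq, -⟩ := hT.existsUnique_path x d.toProd.2
  by_cases h : d.toProd.2 ∈ p.support
  · exact .inr ⟨q, hq, hT.isAcyclic.ne_mem_support_of_support_of_adj_of_isPath hp hq d.adj h⟩
  · exact .inl ⟨p, hp, h⟩

theorem PointsAway.not_symm (hT : T.IsTree) {x : W} {d : T.Dart} (h : PointsAway T x d) :
    ¬ PointsAway T x d.symm := by
  rintro ⟨q, hq, hdq⟩
  obtain ⟨p, hp, hdp⟩ := h
  exact hdp (hT.isAcyclic.mem_support_of_ne_mem_support_of_adj_of_isPath hp hq d.adj hdq)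

theorem PointsAway.eq_of_snd_eq (hT : T.IsTree) {x : W} {d d' : T.Dart}
    (h : PointsAway T x d) (h' : PointsAway T x d') (hs : d.toProd.2 = d'.toProd.2) :
    d = d' := by
  obtain ⟨⟨a, b⟩, hab⟩ := d
  obtain ⟨⟨a', b'⟩, hab'⟩ := d'
  obtain rfl : b = b' := hs
  obtain ⟨p, hp, hbp⟩ := h
  obtain ⟨q, hq, hbq⟩ := h'
  obtain ⟨h, -⟩ := SimpleGraph.Walk.concat_inj
    (hT.path_eq (hp.concat hbp hab) (hq.concat hbq hab'))
  obtain rfl : a = a' := h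
  rfl

/-- A path from the tail of `e` that contains `e` starts with `e`. -/
theorem exists_eq_cons_of_mem_darts {e : T.Dart} {v : W} {p : T.Walk e.toProd.1 v}
    (hp : p.IsPath) (he : e ∈ p.darts) :
    ∃ q : T.Walk e.toProd.2 v, p = .cons e.adj q := by
  obtain ⟨⟨x, y⟩, hxy⟩ := e
  cases p with
  | nil => simp at he
  | cons h q =>
    rw [SimpleGraph.Walk.darts_cons, List.mem_cons] at he
    rcases he with he | he
    · cases he
      exact ⟨q, rfl⟩
    · exact absurd (q.dart_fst_mem_support_of_mem_darts he)
        ((SimpleGraph.Walk.cons_isPath_iff _ _).1 hp).2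

theorem mem_shiftSet_of_mem_support (hT : T.IsTree) {e : T.Dart} {v w : W}
    (hv : v ∈ shiftSet T e) {p : T.Walk e.toProd.1 v} (hp : p.IsPath)
    (hw : w ∈ p.support) : w ∈ shiftSet T e := by
  rcases hv with rfl | hv
  · rw [hT.path_eq hp .nil, SimpleGraph.Walk.support_nil, List.mem_singleton] at hw
    exact .inl hw
  obtain ⟨q, rfl⟩ := exists_eq_cons_of_mem_darts hp (hv p hp)
  rw [SimpleGraph.Walk.support_cons, List.mem_cons] at hw
  refine hw.imp id fun hw r hr => ?_
  rw [SimpleGraph.Walk.cons_isPath_iff] at hp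
  have hq : (SimpleGraph.Walk.cons e.adj (q.takeUntil w hw)).IsPath :=
    (SimpleGraph.Walk.cons_isPath_iff _ _).2
      ⟨hp.1.takeUntil hw, fun h => hp.2 (q.support_takeUntil_subset_support hw h)⟩
  rw [hT.path_eq hr hq]
  simp [SimpleGraph.Walk.darts_cons]

theorem induce_shiftSet_isTree (hT : T.IsTree) (e : T.Dart) :
    (T.induce (shiftSet T e)).IsTree := by
  refine ⟨SimpleGraph.connected_iff_exists_forall_reachable _ |>.2
    ⟨⟨e.toProd.1, .inl rfl⟩, fun v => ?_⟩, hT.isAcyclic.induce _⟩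
  obtain ⟨p, hp, -⟩ := hT.existsUnique_path e.toProd.1 v
  exact ⟨p.induce _ fun w hw => mem_shiftSet_of_mem_support hT v.2 hp hw⟩

theorem dartLE_iff_pointsAway (hT : T.IsTree) {e d : T.Dart}
    (hd : d.toProd.2 ∈ shiftSet T e) : dartLE T e d ↔ PointsAway T e.toProd.1 d := by
  constructor
  · intro h
    refine (pointsAway_or_symm hT _ d).resolve_right ?_
    rintro ⟨q, hq, hdq⟩
    exact hdq (q.dart_fst_mem_support_of_mem_darts (h q hq).2)
  · rintro ⟨p, hp, hdp⟩ q hq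
    rw [hT.path_eq hq (hp.concat hdp d.adj)]
    refine ⟨?_, by simp [SimpleGraph.Walk.darts_concat]⟩
    rcases hd with hd | hd
    · rw [hd] at hdp
      exact absurd p.start_mem_support hdp
    · exact hd _ (hp.concat hdp d.adj)

theorem liftDart_symm {U : Set W} (d : (T.induce U).Dart) :
    liftDart d.symm = (liftDart d).symm := rfl

theorem liftDart_injective {U : Set W} :
    Function.Injective (liftDart : (T.induce U).Dart → T.Dart) := by
  rintro ⟨⟨⟨a, ha⟩, b, hb⟩, h⟩ ⟨⟨⟨a', ha'⟩, b', hb'⟩, h'⟩ heq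
  obtain rfl : a = a' := congrArg (fun d : T.Dart => d.toProd.1) heq
  obtain rfl : b = b' := congrArg (fun d : T.Dart => d.toProd.2) heq
  rfl

theorem not_dartLE_liftDart (hT : T.IsTree) {e : T.Dart}
    {d : (T.induce (shiftSet T e)).Dart} :
    ¬ dartLE T e (liftDart d) ↔ dartLE T e (liftDart d).symm := by
  rw [dartLE_iff_pointsAway hT d.toProd.2.2, dartLE_iff_pointsAway hT d.toProd.1.2]
  exact ⟨(pointsAway_or_symm hT _ _).resolve_left, fun h h' => h'.not_symm hT h⟩

end Tree

section Separation

variable {V : Type*}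

theorem OSep.le_union_left (s t : OSep V) : s.le (s.union t) :=
  ⟨Set.subset_union_left, Set.inter_subset_left⟩

theorem OSep.inter_le_right (s t : OSep V) : (s.inter t).le t :=
  ⟨Set.inter_subset_right, Set.subset_union_right⟩

theorem OSep.le_inter {r s t : OSep V} (hs : r.le s) (ht : r.le t) : r.le (s.inter t) :=
  ⟨Set.subset_inter hs.1 ht.1, Set.union_subset hs.2 ht.2⟩

theorem OSep.le_refl (s : OSep V) : s.le s :=
  ⟨subset_rfl, subset_rfl⟩

theorem OSep.le_trans {r s t : OSep V} (h : r.le s) (h' : s.le t) : r.le t :=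
  ⟨h.1.trans h'.1, h'.2.trans h.2⟩

theorem OSep.flip_le_flip {s t : OSep V} (h : s.le t) : t.flip.le s.flip :=
  ⟨h.2, h.1⟩

theorem OSep.union_le_union {s t : OSep V} (h : s.le t) (r : OSep V) :
    (s.union r).le (t.union r) :=
  ⟨Set.union_subset_union_left _ h.1, Set.inter_subset_inter_left _ h.2⟩

/-- Uncrossing with a linked separation does not increase the order. -/
theorem IsLinkedSep.ord_union_le {S : Set (OSep V)} {ord : OSep V → ℕ} (hU : IsUniverse S)
    (hord : IsOrderFun S ord) {a x s : OSep V} (hx : IsLinkedSep S ord a x) (hs : s ∈ S)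
    (has : a.le s) : ord (s.union x) ≤ ord s := by
  have h : lam S ord a x ≤ ord (s.inter x) :=
    Nat.sInf_le ⟨_, ⟨hU.inter_mem s hs x hx.1, OSep.le_inter has hx.2.1,
      OSep.inter_le_right s x⟩, rfl⟩
  have := hord.submod s hs x hx.1
  have := hx.2.2
  omega

variable {W : Type*} [Fintype W]

theorem isStar_starAt_iff {T : SimpleGraph W} {α : T.Dart → OSep V} {t : W} :
    IsStar (starAt T α t) ↔ ∀ d d' : T.Dart, d.toProd.2 = t → d'.toProd.2 = t → d ≠ d' →
      (α d).le (α d').flip := by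
  constructor
  · intro h d d' hd hd' hne
    refine h _ _ ?_
    have hsub : ({d, d'} : Finset T.Dart) ⊆ Finset.univ.filter fun d => d.toProd.2 = t := by
      intro f hf
      rw [Finset.mem_insert, Finset.mem_singleton] at hf
      rcases hf with rfl | rfl <;> simp [*]
    have := Multiset.map_le_map (f := α) (Finset.val_le_iff.2 hsub)
    rwa [Finset.insert_val_of_notMem (by simpa using hne), Multiset.map_cons,
      Finset.singleton_val, Multiset.map_singleton] at this
  · intro h a b hab
    obtain ⟨d, hd, rfl⟩ := Multiset.mem_map.1
      (Multiset.mem_of_le hab (Multiset.mem_cons_self _ _))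
    rw [starAt, ← Multiset.cons_erase hd, Multiset.map_cons, Multiset.cons_le_cons_iff,
      Multiset.singleton_le, Multiset.mem_map] at hab
    obtain ⟨d', hd', rfl⟩ := hab
    have hd'' := Multiset.mem_of_mem_erase hd'
    rw [Finset.mem_val, Finset.mem_filter] at hd hd''
    refine h d d' hd.2 hd''.2 ?_
    rintro rfl
    exact (Finset.nodup _).notMem_erase hd'

/-- In a tame tree the labels increase along paths. -/
theorem le_of_mem_darts_of_isPath {T : SimpleGraph W} {α : T.Dart → OSep V}
    (hinv : ∀ d, α d.symm = (α d).flip) (htame : ∀ t, IsStar (starAt T α t))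
    {u v w : W} (h : T.Adj u v) (p : T.Walk v w) (hp : (SimpleGraph.Walk.cons h p).IsPath)
    {d : T.Dart} (hd : d ∈ (SimpleGraph.Walk.cons h p).darts) :
    (α ⟨(u, v), h⟩).le (α d) := by
  induction p generalizing u with
  | nil =>
    rw [SimpleGraph.Walk.darts_cons, SimpleGraph.Walk.darts_nil, List.mem_singleton] at hd
    rw [hd]
    exact OSep.le_refl _
  | @cons v v' w h' p ih =>
    rw [SimpleGraph.Walk.darts_cons, List.mem_cons] at hd
    rcases hd with rfl | hd
    · exact OSep.le_refl _
    · rw [SimpleGraph.Walk.cons_isPath_iff] at hp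
      refine OSep.le_trans ?_ (ih h' hp.1 hd)
      have hne : (⟨(u, v), h⟩ : T.Dart) ≠ ⟨(v', v), h'.symm⟩ := by
        intro heq
        have huv : u = v' := congrArg (fun d : T.Dart => d.toProd.1) heq
        exact hp.2 (by simp [huv])
      have := isStar_starAt_iff.1 (htame v) _ _ rfl rfl hne
      rwa [← hinv] at this

theorem le_of_dartLE {T : SimpleGraph W} (hT : T.IsTree) {α : T.Dart → OSep V}
    (hinv : ∀ d, α d.symm = (α d).flip) (htame : ∀ t, IsStar (starAt T α t))
    {e d : T.Dart} (h : dartLE T e d) : (α e).le (α d) := by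
  obtain ⟨p, hp, -⟩ := hT.existsUnique_path e.toProd.1 d.toProd.2
  obtain ⟨he, hd⟩ := h p hp
  obtain ⟨q, rfl⟩ := exists_eq_cons_of_mem_darts hp he
  exact le_of_mem_darts_of_isPath hinv htame e.adj q hp hd

end Separation

/-- Lemma `l:shift1`. The shift of a tame `S_k`-tree `(T,α)` onto a
separation `(X,Y)` linked to `α(e⃗)`, with respect to `e⃗`, is a tame `S_k`-tree. -/
theorem shift_isTame_Sk {V : Type*} [Fintype V] (S : Set (OSep V)) (ord : OSep V → ℕ)
    (k : ℕ) (hU : IsUniverse S) (hord : IsOrderFun S ord)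
    (n : ℕ) (T : SimpleGraph (Fin n)) (hT : T.IsTree) (α : T.Dart → OSep V)
    (hinv : ∀ d, α d.symm = (α d).flip) (hrange : ∀ d, α d ∈ S ∧ ord (α d) < k)
    (htame : ∀ t, IsStar (starAt T α t))
    (e : T.Dart) (X : OSep V) (hlinked : IsLinkedSep S ord (α e) X) :
    (T.induce (shiftSet T e)).IsTree ∧
    (∀ d, shiftAlpha T α e X d.symm = (shiftAlpha T α e X d).flip) ∧
    (∀ d, shiftAlpha T α e X d ∈ S ∧ ord (shiftAlpha T α e X d) < k) ∧
    (∀ t, IsStar (starAt (T.induce (shiftSet T e)) (shiftAlpha T α e X) t)) := by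
  have hpos : ∀ d, dartLE T e (liftDart d) →
      shiftAlpha T α e X d = (α (liftDart d)).union X := fun d hd => if_pos hd
  have hneg : ∀ d, ¬ dartLE T e (liftDart d) →
      shiftAlpha T α e X d = ((α (liftDart d)).flip.union X).flip := fun d hd => by
    rw [shiftAlpha, if_neg hd, hinv]
  have hsymm : ∀ d, shiftAlpha T α e X d.symm = (shiftAlpha T α e X d).flip := by
    intro d
    by_cases hd : dartLE T e (liftDart d)
    · have hd' : ¬ dartLE T e (liftDart d.symm) := by
        rwa [not_dartLE_liftDart hT, liftDart_symm, SimpleGraph.Dart.symm_symm]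
      rw [hpos d hd, hneg _ hd', liftDart_symm, hinv]
      rfl
    · rw [hneg d hd, hpos d.symm ((not_dartLE_liftDart hT).1 hd), liftDart_symm, hinv]
      rfl
  have hSk : ∀ d, dartLE T e d → (α d).union X ∈ S ∧ ord ((α d).union X) < k := fun d hd =>
    ⟨hU.union_mem _ (hrange d).1 _ hlinked.1,
      (hlinked.ord_union_le hU hord (hrange d).1
        (le_of_dartLE hT hinv htame hd)).trans_lt (hrange d).2⟩
  refine ⟨induce_shiftSet_isTree hT e, hsymm, fun d => ?_, fun t => ?_⟩
  · by_cases hd : dartLE T e (liftDart d)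
    · rw [hpos d hd]
      exact hSk _ hd
    · rw [hneg d hd, ← hinv]
      obtain ⟨h₁, h₂⟩ := hSk _ ((not_dartLE_liftDart hT).1 hd)
      exact ⟨hU.flip_mem _ h₁, (hord.symm _ h₁).trans_lt h₂⟩
  rw [isStar_starAt_iff]
  intro d d' hdt hd't hne
  have hsnd : (liftDart d).toProd.2 = (liftDart d').toProd.2 :=
    congrArg Subtype.val (hdt.trans hd't.symm)
  have hne' : liftDart d ≠ liftDart d' := liftDart_injective.ne hne
  have hle := isStar_starAt_iff.1 (htame _) _ _ hsnd rfl hne'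
  by_cases hd : dartLE T e (liftDart d) <;> by_cases hd' : dartLE T e (liftDart d')
  · rw [dartLE_iff_pointsAway hT d.toProd.2.2] at hd
    rw [dartLE_iff_pointsAway hT d'.toProd.2.2] at hd'
    exact absurd (hd.eq_of_snd_eq hT hd' hsnd) hne'
  · rw [hpos d hd, hneg d' hd']
    exact OSep.union_le_union hle X
  · rw [hneg d hd, hpos d' hd']
    exact OSep.flip_le_flip (OSep.union_le_union (OSep.flip_le_flip hle) X)
  · rw [hneg d hd, hneg d' hd']
    exact OSep.le_trans (OSep.flip_le_flip (OSep.le_union_left _ X))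
      (OSep.le_trans hle (OSep.le_union_left _ X))
end
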